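/- There is no continuous map a : S² → M₂(ℂ) such that for every x ∈ S² the matrix a(x) is a self-adjoint unitary and a is odd, i.e., u_x a(x) u_x = −a(x) for all x ∈ S². (Equivalently, the ℤ/2-action on C(S², M₂(ℂ)) given by pointwise conjugation by u_x has nonzero weak, plain, and strong local-triviality dimensions.) -/

import Mathlib

/-- The unit sphere `S² ⊆ ℝ³`. -/
def sphere2 : Set (Fin 3 → ℝ) := {x | x 0 ^ 2 + x 1 ^ 2 + x 2 ^ 2 = 1}

/-- For `x = (x₁, x₂, x₃) ∈ S²`, the self-adjoint unitary
`u_x = [[x₃, x₁ - i·x₂], [x₁ + i·x₂, -x₃]] ∈ M₂(ℂ)`. -/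
noncomputable def uMat (x : Fin 3 → ℝ) : Matrix (Fin 2) (Fin 2) ℂ :=
  !![(x 2 : ℂ), (x 0 : ℂ) - Complex.I * (x 1 : ℂ);
     (x 0 : ℂ) + Complex.I * (x 1 : ℂ), -(x 2 : ℂ)]

open Complex in
/-- A nowhere vanishing continuous function on the plane has a continuous logarithm. -/
theorem exists_clog (f : C(ℂ, ℂ)) (hf : ∀ w, f w ≠ 0) :
    ∃ L : C(ℂ, ℂ), ∀ w, Complex.exp (L w) = f w := by
  obtain ⟨F, ⟨_, hF⟩, _⟩ := Complex.isCoveringMapOn_exp.existsUnique_continuousMap_lifts f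
    (a₀ := 0) (e₀ := Complex.log (f 0)) (Complex.exp_log (hf 0)) (fun a => by simpa using hf a)
  exact ⟨F, fun w => congrFun hF w⟩

/-- The winding number obstruction: `w ^ 2` has no continuous logarithm on the circle. -/
theorem winding_two (f g : C(ℂ, ℂ)) (hf : ∀ w, f w ≠ 0) (hg : ∀ w, g w ≠ 0)
    (h : ∀ w : ℂ, w * (starRingEnd ℂ) w = 1 → f w = w ^ 2 * g w) : False := by
  obtain ⟨F, hF⟩ := exists_clog f hf
  obtain ⟨G, hG⟩ := exists_clog g hg
  let c : C(ℝ, ℂ) := ⟨fun t => Complex.exp (t * Complex.I), by fun_prop⟩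
  have hc : ∀ t, c t = Complex.exp (t * Complex.I) := fun t => rfl
  have hc1 : ∀ t, c t * (starRingEnd ℂ) (c t) = 1 := by
    intro t
    rw [hc, ← Complex.exp_conj, ← Complex.exp_add]
    simp
  let q : C(ℝ, ℂ) := ⟨fun t => (c t) ^ 2, by fun_prop⟩
  let k : ℂ := F 1 - G 1
  have c0 : c 0 = 1 := by simp [hc]
  have c2 : c (2 * Real.pi) = 1 := by
    rw [hc]; push_cast; exact Complex.exp_two_pi_mul_I
  have key : ∀ t, Complex.exp (F (c t) - G (c t)) = c t ^ 2 := by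
    intro t
    rw [Complex.exp_sub, hF, hG, h _ (hc1 t)]
    field_simp [hg (c t)]
  have e1 : Complex.exp k = q 0 := by
    have := key 0
    rw [c0] at this
    simpa [q, k, c0] using this
  let A : C(ℝ, ℂ) := ⟨fun t => F (c t) - G (c t), by fun_prop⟩
  let B : C(ℝ, ℂ) := ⟨fun t => 2 * (t * Complex.I) + k, by fun_prop⟩
  have hu := Complex.isCoveringMapOn_exp.existsUnique_continuousMap_lifts q
    (a₀ := 0) (e₀ := k) e1 (fun a => by simp [q, hc])
  have hAB : A = B := by
    refine hu.unique ⟨?_, ?_⟩ ⟨?_, ?_⟩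
    · simp [A, c0, k]
    · funext t; exact key t
    · simp [B]
    · funext t
      have : Complex.exp k = 1 := by simpa [q, c0] using e1
      change Complex.exp (2 * (t * Complex.I) + k) = (Complex.exp (t * Complex.I)) ^ 2
      rw [Complex.exp_add, this, mul_one, ← Complex.exp_nat_mul]; norm_num
  have := DFunLike.congr_fun hAB (2 * Real.pi)
  change F (c (2 * Real.pi)) - G (c (2 * Real.pi)) = 2 * (((2 * Real.pi : ℝ) : ℂ) * Complex.I) + k
    at this
  rw [c2] at this
  have h0 : 2 * (((2 * Real.pi : ℝ) : ℂ) * Complex.I) = 0 := by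
    linear_combination (-1 : ℂ) * this
  simp [Real.pi_ne_zero] at h0

/-- An odd unitary cannot have a fixed vector of `u` as an eigenvector. -/
theorem no_eig (u a : Matrix (Fin 2) (Fin 2) ℂ) (ha : star a * a = 1) (h : u * a * u = -a)
    (v : Fin 2 → ℂ) (s p : ℂ) (hs : s * s = 1) (huv : u.mulVec v = s • v)
    (hav : a.mulVec v = p • v) : v = 0 := by
  have h1 : (u * a * u).mulVec v = p • v := by
    rw [← Matrix.mulVec_mulVec, huv, Matrix.mulVec_smul, ← Matrix.mulVec_mulVec, hav,
      Matrix.mulVec_smul, huv, smul_smul, smul_smul]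
    congr 1; linear_combination p * hs
  rw [h, Matrix.neg_mulVec, hav] at h1
  have h2 : p • v = 0 := self_eq_neg.mp h1.symm
  rw [← hav] at h2
  have := congrArg (star a).mulVec h2
  rwa [Matrix.mulVec_mulVec, ha, Matrix.one_mulVec, Matrix.mulVec_zero] at this

/-- Stereographic parametrization (`e = 1`: north chart, `e = -1`: south chart). -/
noncomputable def stereo (e : ℝ) (w : ℂ) : Fin 3 → ℝ :=
  ![2 * w.re / (1 + w.re ^ 2 + w.im ^ 2), 2 * w.im / (1 + w.re ^ 2 + w.im ^ 2),
    e * (1 - w.re ^ 2 - w.im ^ 2) / (1 + w.re ^ 2 + w.im ^ 2)]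

theorem den_pos (w : ℂ) : 0 < 1 + w.re ^ 2 + w.im ^ 2 := by positivity

theorem stereo_mem (e : ℝ) (he : e ^ 2 = 1) (w : ℂ) : stereo e w ∈ sphere2 := by
  have := (den_pos w).ne'
  simp only [sphere2, stereo, Set.mem_ofPred_eq, Matrix.cons_val]
  field_simp
  rw [he]; ring

theorem stereo_cont (e : ℝ) : Continuous (stereo e) := by
  have h := fun w => (den_pos w).ne'
  unfold stereo
  refine continuous_pi fun i => ?_
  fin_cases i <;> simp <;> fun_prop (disch := exact h _)

theorem uMat_stereo_N (w : ℂ) :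
    (uMat (stereo 1 w)).mulVec ![1, w] = (1 : ℂ) • ![1, w] := by
  have hd := (den_pos w).ne'
  have h0 : stereo 1 w 2 + stereo 1 w 0 * w.re + stereo 1 w 1 * w.im = 1 := by
    simp only [stereo, Matrix.cons_val]
    field_simp
    ring
  have h1 : stereo 1 w 0 * w.im - stereo 1 w 1 * w.re = 0 := by
    simp only [stereo, Matrix.cons_val]
    field_simp
    ring
  have h2 : stereo 1 w 0 - stereo 1 w 2 * w.re = w.re := by
    simp only [stereo, Matrix.cons_val]
    field_simp
    ring
  have h3 : stereo 1 w 1 - stereo 1 w 2 * w.im = w.im := by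
    simp only [stereo, Matrix.cons_val]
    field_simp
    ring
  generalize stereo 1 w = y at *
  ext i
  fin_cases i <;> simp [uMat, Matrix.mulVec, dotProduct, Fin.sum_univ_two] <;>
    apply Complex.ext <;> simp <;> linarith

theorem uMat_stereo_S (w : ℂ) :
    (uMat (stereo (-1) w)).mulVec ![(starRingEnd ℂ) w, 1] = (1 : ℂ) • ![(starRingEnd ℂ) w, 1] := by
  have hd := (den_pos w).ne'
  have h0 : -stereo (-1) w 2 + stereo (-1) w 0 * w.re + stereo (-1) w 1 * w.im = 1 := by
    simp only [stereo, Matrix.cons_val]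
    field_simp
    ring
  have h1 : stereo (-1) w 0 * w.im - stereo (-1) w 1 * w.re = 0 := by
    simp only [stereo, Matrix.cons_val]
    field_simp
    ring
  have h2 : stereo (-1) w 0 + stereo (-1) w 2 * w.re = w.re := by
    simp only [stereo, Matrix.cons_val]
    field_simp
    ring
  have h3 : stereo (-1) w 1 + stereo (-1) w 2 * w.im = w.im := by
    simp only [stereo, Matrix.cons_val]
    field_simp
    ring
  generalize stereo (-1) w = y at *
  ext i
  fin_cases i <;> simp [uMat, Matrix.mulVec, dotProduct, Fin.sum_univ_two] <;>
    apply Complex.ext <;> simp <;> linarith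

/-- There is no continuous map `a : S² → M₂(ℂ)` whose values are
self-adjoint unitaries and which is odd: `u_x a(x) u_x = -a(x)` for all `x ∈ S²`. -/
theorem stmt8 :
    ¬ ∃ a : ↥sphere2 → Matrix (Fin 2) (Fin 2) ℂ,
      Continuous a ∧
      (∀ x, IsSelfAdjoint (a x)) ∧
      (∀ x, a x ∈ unitary (Matrix (Fin 2) (Fin 2) ℂ)) ∧
      (∀ x : ↥sphere2, uMat x.1 * a x * uMat x.1 = -(a x)) := by
  rintro ⟨a, hcont, -, hun, hodd⟩
  let N : ℂ → sphere2 := fun w => ⟨stereo 1 w, stereo_mem 1 (by norm_num) w⟩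
  let S : ℂ → sphere2 := fun w => ⟨stereo (-1) w, stereo_mem (-1) (by norm_num) w⟩
  have hN : Continuous N := (stereo_cont 1).subtype_mk _
  have hS : Continuous S := (stereo_cont (-1)).subtype_mk _
  have hNc : ∀ i j, Continuous fun w => a (N w) i j := fun i j =>
    (hcont.comp hN).matrix_elem i j
  have hSc : ∀ i j, Continuous fun w => a (S w) i j := fun i j =>
    (hcont.comp hS).matrix_elem i j
  let f : C(ℂ, ℂ) := ⟨fun w => -w * (a (N w) 0 0 + a (N w) 0 1 * w)
    + (a (N w) 1 0 + a (N w) 1 1 * w), by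
      exact (continuous_id.neg.mul ((hNc 0 0).add ((hNc 0 1).mul continuous_id))).add
        ((hNc 1 0).add ((hNc 1 1).mul continuous_id))⟩
  let g : C(ℂ, ℂ) := ⟨fun w => -(a (S w) 0 0 * (starRingEnd ℂ) w + a (S w) 0 1)
    + (starRingEnd ℂ) w * (a (S w) 1 0 * (starRingEnd ℂ) w + a (S w) 1 1), by
      have hk := Complex.continuous_conj
      exact (((hSc 0 0).mul hk).add (hSc 0 1)).neg.add
        (hk.mul (((hSc 1 0).mul hk).add (hSc 1 1)))⟩
  refine winding_two f g ?_ ?_ ?_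
  · intro w hw
    change -w * (a (N w) 0 0 + a (N w) 0 1 * w) + (a (N w) 1 0 + a (N w) 1 1 * w) = 0 at hw
    have hv := no_eig (uMat (N w).1) (a (N w)) (hun (N w)).1 (hodd (N w)) ![1, w] 1
      (a (N w) 0 0 + a (N w) 0 1 * w) (by norm_num) ?_ ?_
    · simpa using congrFun hv 0
    · exact uMat_stereo_N w
    · ext i
      fin_cases i <;> simp [Matrix.mulVec, dotProduct, Fin.sum_univ_two]
      linear_combination hw
  · intro w hw
    change -(a (S w) 0 0 * (starRingEnd ℂ) w + a (S w) 0 1)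
      + (starRingEnd ℂ) w * (a (S w) 1 0 * (starRingEnd ℂ) w + a (S w) 1 1) = 0 at hw
    have hv := no_eig (uMat (S w).1) (a (S w)) (hun (S w)).1 (hodd (S w))
      ![(starRingEnd ℂ) w, 1] 1
      (a (S w) 1 0 * (starRingEnd ℂ) w + a (S w) 1 1) (by norm_num) ?_ ?_
    · simpa using congrFun hv 1
    · exact uMat_stereo_S w
    · ext i
      fin_cases i <;> simp [Matrix.mulVec, dotProduct, Fin.sum_univ_two]
      linear_combination -hw
  · intro w hw
    have hr : 1 - w.re ^ 2 - w.im ^ 2 = 0 := by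
      have := congrArg Complex.re hw
      simp at this
      linarith
    have hNS : N w = S w := by
      apply Subtype.ext
      change stereo 1 w = stereo (-1) w
      simp [stereo, hr]
    change -w * (a (N w) 0 0 + a (N w) 0 1 * w) + (a (N w) 1 0 + a (N w) 1 1 * w) =
      w ^ 2 * (-(a (S w) 0 0 * (starRingEnd ℂ) w + a (S w) 0 1)
      + (starRingEnd ℂ) w * (a (S w) 1 0 * (starRingEnd ℂ) w + a (S w) 1 1))
    rw [hNS]
    generalize (starRingEnd ℂ) w = z at *
    linear_combination (w * a (S w) 0 0 - w * a (S w) 1 1 - (w * z + 1) * a (S w) 1 0) * hw
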